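/- (Classification of fourfolds with trivial canonical bundle in the maximal odd orthogonal Grassmannians OGr(n,2n+1).) Let n ≥ 2 and let β¹, …, β^m be nonzero n-tuples with β₁ ≥ … ≥ β_n ≥ 0, each with entries all integers or all half-odd-integers, such that: no β^i equals (1,0,…,0); at least one β^i has non-integer entries; ∑_i D_n(β^i) = n(n+1)/2 − 4; and ∑_i ((β^i₁ + … + β^i_n)/n) · D_n(β^i) = n. Then, up to reordering, (n, (β¹,…,β^m)) is one of the following seven: (1) n=3: (1/2,1/2,1/2), (5/2,5/2,5/2); (2) n=3: (3/2,3/2,3/2) twice; (3) n=4: (1/2,1/2,1/2,1/2) twice, (1,1,1,0); (4) n=4: (1/2,1/2,1/2,1/2) twice, (3/2,1/2,1/2,1/2); (5) n=4: (1/2,1/2,1/2,1/2) five times, (3/2,3/2,3/2,3/2); (6) n=4: (1/2,1/2,1/2,1/2) four times, (1,1,1,1) twice; (7) n=6: (1/2,1/2,1/2,1/2,1/2,1/2) twice, (1,1,0,0,0,0). -/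

import Mathlib

open Finset

/-- Weyl dimension formula `D_r` for `sl(r)`, applied to the entries
`β 0, …, β (r-1)` (0-indexed versions of `β₁, …, β_r`). -/
def slDim (r : ℕ) (β : ℕ → ℚ) : ℚ :=
  ∏ i ∈ Finset.range r, ∏ j ∈ Finset.range r,
    if i < j then ((j : ℚ) - (i : ℚ) + β i - β j) / ((j : ℚ) - (i : ℚ)) else 1

/-- Weyl dimension formula `C_m` for `sp(2m)`. -/
def spDim (m : ℕ) (β : ℕ → ℚ) : ℚ :=
  slDim m β *
    ∏ i ∈ Finset.range m, ∏ j ∈ Finset.range m,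
      if i ≤ j then
        ((2 * m : ℚ) - (i : ℚ) - (j : ℚ) + β i + β j) /
          ((2 * m : ℚ) - (i : ℚ) - (j : ℚ))
      else 1

/-- Weyl dimension formula `B_m` for `so(2m+1)`. -/
def soOddDim (m : ℕ) (β : ℕ → ℚ) : ℚ :=
  slDim m β *
    ∏ i ∈ Finset.range m, ∏ j ∈ Finset.range m,
      if i ≤ j then
        ((2 * m : ℚ) - 1 - (i : ℚ) - (j : ℚ) + β i + β j) /
          ((2 * m : ℚ) - 1 - (i : ℚ) - (j : ℚ))
      else 1

/-- Weyl dimension formula `E_m` for `so(2m)`. -/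
def soEvenDim (m : ℕ) (β : ℕ → ℚ) : ℚ :=
  slDim m β *
    ∏ i ∈ Finset.range m, ∏ j ∈ Finset.range m,
      if i < j then
        ((2 * m : ℚ) - 2 - (i : ℚ) - (j : ℚ) + β i + β j) /
          ((2 * m : ℚ) - 2 - (i : ℚ) - (j : ℚ))
      else 1

/-- The tuple determined by a list, extended by zeros. -/
def lw (l : List ℚ) : ℕ → ℚ := fun i => l.getD i 0

/-- `β₁ + ⋯ + β_k` (the sum of the first `k` entries). -/
def headSum (k : ℕ) (β : ℕ → ℚ) : ℚ := ∑ i ∈ Finset.range k, β i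

/-- A weight for the ordinary Grassmannian `Gr(k,n)`: integers
`β₁ ≥ β₂ ≥ ⋯ ≥ β_n = 0`, extended by zeros beyond position `n`. -/
def IsGrWeight (n : ℕ) (β : ℕ → ℚ) : Prop :=
  (∀ i, ∃ z : ℤ, β i = (z : ℚ)) ∧ (∀ i j, i ≤ j → β j ≤ β i) ∧ ∀ i, n - 1 ≤ i → β i = 0

/-- `rank(β) = D_k(β₁,…,β_k) ⬝ D_{n-k}(β_{k+1},…,β_n)` on `Gr(k,n)`. -/
def grRank (k n : ℕ) (β : ℕ → ℚ) : ℚ := slDim k β * slDim (n - k) (fun i => β (k + i))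

/-- `dex(β) = (|β|₁/k − |β|₂/(n−k)) ⬝ rank(β)` on `Gr(k,n)`. -/
def grDex (k n : ℕ) (β : ℕ → ℚ) : ℚ :=
  (headSum k β / (k : ℚ) -
      (∑ i ∈ Finset.range (n - k), β (k + i)) / ((n : ℚ) - (k : ℚ))) * grRank k n β

/-- A weight for the symplectic Grassmannian `IGr(k,2n)`: integers
`β₁ ≥ ⋯ ≥ β_n ≥ 0`, extended by zeros beyond position `n`. -/
def IsIGrWeight (n : ℕ) (β : ℕ → ℚ) : Prop :=
  (∀ i, ∃ z : ℤ, β i = (z : ℚ)) ∧ (∀ i j, i ≤ j → β j ≤ β i) ∧ ∀ i, n ≤ i → β i = 0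

/-- `rank(β) = D_k(β₁,…,β_k) ⬝ C_{n-k}(β_{k+1},…,β_n)` on `IGr(k,2n)`. -/
def igrRank (k n : ℕ) (β : ℕ → ℚ) : ℚ := slDim k β * spDim (n - k) (fun i => β (k + i))

/-- `dex(β) = ((β₁+⋯+β_k)/k) ⬝ rank(β)` on `IGr(k,2n)`. -/
def igrDex (k n : ℕ) (β : ℕ → ℚ) : ℚ := headSum k β / (k : ℚ) * igrRank k n β

/-- A weight for the odd orthogonal Grassmannian `OGr(k,2n+1)`:
`β₁ ≥ ⋯ ≥ β_n ≥ 0`, all entries integers or all half-odd-integers,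
extended by zeros beyond position `n`. -/
def IsOGrOddWeight (n : ℕ) (β : ℕ → ℚ) : Prop :=
  ((∀ i, i < n → ∃ z : ℤ, β i = (z : ℚ)) ∨
    (∀ i, i < n → ∃ z : ℤ, β i = (z : ℚ) + 1/2)) ∧
  (∀ i j, i ≤ j → j < n → β j ≤ β i) ∧ (∀ i, i < n → 0 ≤ β i) ∧ ∀ i, n ≤ i → β i = 0

/-- `rank(β) = D_k(β₁,…,β_k) ⬝ B_{n-k}(β_{k+1},…,β_n)` on `OGr(k,2n+1)`. -/
def ogrOddRank (k n : ℕ) (β : ℕ → ℚ) : ℚ :=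
  slDim k β * soOddDim (n - k) (fun i => β (k + i))

/-- `dex(β) = ((β₁+⋯+β_k)/k) ⬝ rank(β)` on `OGr(k,2n+1)`. -/
def ogrOddDex (k n : ℕ) (β : ℕ → ℚ) : ℚ := headSum k β / (k : ℚ) * ogrOddRank k n β

/-- A weight for the even orthogonal Grassmannian `OGr(k,2n)`:
`β₁ ≥ ⋯ ≥ β_{n-1} ≥ |β_n|`, all entries integers or all half-odd-integers,
extended by zeros beyond position `n`. -/
def IsOGrEvenWeight (n : ℕ) (β : ℕ → ℚ) : Prop :=
  ((∀ i, i < n → ∃ z : ℤ, β i = (z : ℚ)) ∨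
    (∀ i, i < n → ∃ z : ℤ, β i = (z : ℚ) + 1/2)) ∧
  (∀ i j, i ≤ j → j + 1 < n → β j ≤ β i) ∧
  (∀ i, i + 1 < n → |β (n - 1)| ≤ β i) ∧ ∀ i, n ≤ i → β i = 0

/-- `rank(β) = D_k(β₁,…,β_k) ⬝ E_{n-k}(β_{k+1},…,β_n)` on `OGr(k,2n)`. -/
def ogrEvenRank (k n : ℕ) (β : ℕ → ℚ) : ℚ :=
  slDim k β * soEvenDim (n - k) (fun i => β (k + i))

/-- `dex(β) = ((β₁+⋯+β_k)/k) ⬝ rank(β)` on `OGr(k,2n)`. -/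
def ogrEvenDex (k n : ℕ) (β : ℕ → ℚ) : ℚ := headSum k β / (k : ℚ) * ogrEvenRank k n β

/-- Replace the last entry `β_n` by its negative. -/
def negLast (n : ℕ) (β : ℕ → ℚ) : ℕ → ℚ := fun i => if i = n - 1 then -β i else β i

lemma slDim_zero (β : ℕ → ℚ) : slDim 0 β = 1 := by simp [slDim]

/-- Splitting off the factors that involve the last entry. -/
lemma slDim_succ (n : ℕ) (β : ℕ → ℚ) :
    slDim (n + 1) β =
      slDim n β * ∏ i ∈ Finset.range n, ((n : ℚ) - i + β i - β n) / ((n : ℚ) - i) := by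
  unfold slDim
  rw [Finset.prod_range_succ]
  have h1 : ∏ j ∈ Finset.range (n + 1),
      (if n < j then ((j : ℚ) - (n : ℚ) + β n - β j) / ((j : ℚ) - (n : ℚ)) else 1) = 1 := by
    refine Finset.prod_eq_one fun j hj => ?_
    rw [if_neg]
    have := Finset.mem_range.1 hj
    omega
  rw [h1, mul_one, ← Finset.prod_mul_distrib]
  refine Finset.prod_congr rfl fun i hi => ?_
  rw [Finset.prod_range_succ, if_pos (Finset.mem_range.1 hi)]

lemma one_le_slDim_factor {n i : ℕ} (hi : i < n) {β : ℕ → ℚ} (h : β n ≤ β i) :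
    1 ≤ ((n : ℚ) - i + β i - β n) / ((n : ℚ) - i) := by
  have : (i : ℚ) < n := by exact_mod_cast hi
  rw [le_div_iff₀ (by linarith)]
  linarith

/-- If the first `k` entries exceed the last one by at least `1`, the factors involving the last
entry multiply to at least `(n + 1) / (n + 1 - k)`. -/
lemma le_prod_slDim_factor {n k : ℕ} (hk : k ≤ n) {β : ℕ → ℚ}
    (h : ∀ i < n, β n ≤ β i) (hs : ∀ i < k, β n + 1 ≤ β i) :
    ((n : ℚ) + 1) / (n + 1 - k) ≤
      ∏ i ∈ Finset.range n, ((n : ℚ) - i + β i - β n) / ((n : ℚ) - i) := by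
  have key : ∀ m ≤ k, ((n : ℚ) + 1) / (n + 1 - m) ≤
      ∏ i ∈ Finset.range m, ((n : ℚ) - i + β i - β n) / ((n : ℚ) - i) := by
    intro m
    induction m with
    | zero =>
      intro _
      have : (n : ℚ) + 1 ≠ 0 := by positivity
      simp [this]
    | succ m ih =>
      intro hm
      have hmn : (m : ℚ) + 1 ≤ n := by exact_mod_cast hm.trans hk
      have e : ((n : ℚ) + 1) / (n + 1 - (m + 1 : ℕ)) =
          ((n : ℚ) + 1) / (n + 1 - m) * (((n : ℚ) - m + 1) / ((n : ℚ) - m)) := by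
        have h1 : (n : ℚ) - m ≠ 0 := by linarith
        have h2 : (n : ℚ) + 1 - m ≠ 0 := by linarith
        have h3 : (n : ℚ) + 1 - (m + 1) ≠ 0 := by linarith
        push_cast
        field_simp
        ring
      rw [e, Finset.prod_range_succ]
      have h0 : (0 : ℚ) < n - m := by linarith
      refine mul_le_mul (ih (by omega)) ?_ ?_ ?_
      · exact div_le_div_of_nonneg_right (by linarith [hs m hm]) h0.le
      · exact div_nonneg (by linarith) h0.le
      · exact le_trans (div_nonneg (by linarith) (by linarith)) (ih (by omega))
  have ext : ∀ m, k ≤ m → m ≤ n → ((n : ℚ) + 1) / (n + 1 - k) ≤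
      ∏ i ∈ Finset.range m, ((n : ℚ) - i + β i - β n) / ((n : ℚ) - i) := by
    intro m hm
    induction m, hm using Nat.le_induction with
    | base => exact fun _ => key k le_rfl
    | succ m hm ih =>
      intro hmn
      rw [Finset.prod_range_succ]
      have hk' : (k : ℚ) ≤ n := by exact_mod_cast hk
      have := ih (by omega)
      exact this.trans (le_mul_of_one_le_right
        ((div_nonneg (by positivity) (by linarith)).trans this)
        (one_le_slDim_factor hmn (h m hmn)))
  exact ext n hk le_rfl

lemma one_le_slDim {n : ℕ} {β : ℕ → ℚ} (h : ∀ i j, i ≤ j → j < n → β j ≤ β i) :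
    1 ≤ slDim n β := by
  induction n with
  | zero => simp [slDim_zero]
  | succ n ih =>
    rw [slDim_succ]
    have h1 := ih fun i j hij hj => h i j hij (by omega)
    have h2 := le_prod_slDim_factor (Nat.zero_le n) (fun i hi => h i n hi.le (by omega))
      (by simp)
    have : ((n : ℚ) + 1) / (n + 1 - (0 : ℕ)) = 1 := by
      have : (n : ℚ) + 1 ≠ 0 := by positivity
      simp [this]
    rw [this] at h2
    exact one_le_mul_of_one_le_of_one_le h1 h2

lemma le_slDim_of_step {n k : ℕ} (hk : k + 1 < n) {β : ℕ → ℚ}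
    (h : ∀ i j, i ≤ j → j < n → β j ≤ β i) (hs : β (k + 1) + 1 ≤ β k) :
    (n : ℚ) ≤ slDim n β := by
  induction n with
  | zero => omega
  | succ n ih =>
    rw [slDim_succ]
    have h' : ∀ i j, i ≤ j → j < n → β j ≤ β i := fun i j hij hj => h i j hij (by omega)
    have hlast : ∀ i < k + 1, β n + 1 ≤ β i := fun i hi => by
      linarith [h i k (by omega) (by omega), h (k + 1) n (by omega) (by omega)]
    have hn : (1 : ℚ) ≤ n := by exact_mod_cast (by omega : 1 ≤ n)
    by_cases hkn : k + 1 < n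
    · have h2 := le_prod_slDim_factor (k := 1) (by omega)
        (fun i hi => h i n hi.le (by omega)) (fun i hi => hlast i (by omega))
      calc ((n + 1 : ℕ) : ℚ) = n * (((n : ℚ) + 1) / (n + 1 - (1 : ℕ))) := by
            push_cast
            rw [add_sub_cancel_right, mul_div_cancel₀ _ (by linarith)]
        _ ≤ _ := mul_le_mul (ih hkn h') h2
            (div_nonneg (by positivity) (by push_cast; linarith))
            (le_trans zero_le_one (one_le_slDim h'))
    · obtain rfl : k + 1 = n := by omega
      have h2 := le_prod_slDim_factor le_rfl (fun i hi => h i _ hi.le (by omega)) hlast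
      rw [add_sub_cancel_left, div_one] at h2
      push_cast at h2 ⊢
      exact h2.trans (le_mul_of_one_le_left (le_trans (by positivity) h2) (one_le_slDim h'))

lemma le_slDim_of_interior_step {n k : ℕ} (hk1 : 1 ≤ k) (hk : k + 2 < n) {β : ℕ → ℚ}
    (h : ∀ i j, i ≤ j → j < n → β j ≤ β i) (hs : β (k + 1) + 1 ≤ β k) :
    (n : ℚ) * (n - 1) / 2 ≤ slDim n β := by
  induction n with
  | zero => omega
  | succ n ih =>
    rw [slDim_succ]
    have h' : ∀ i j, i ≤ j → j < n → β j ≤ β i := fun i j hij hj => h i j hij (by omega)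
    have hlast : ∀ i < k + 1, β n + 1 ≤ β i := fun i hi => by
      linarith [h i k (by omega) (by omega), h (k + 1) n (by omega) (by omega)]
    have hn : (3 : ℚ) ≤ n := by exact_mod_cast (by omega : 3 ≤ n)
    by_cases hkn : k + 2 < n
    · have h2 := le_prod_slDim_factor (k := 2) (by omega)
        (fun i hi => h i n hi.le (by omega)) (fun i hi => hlast i (by omega))
      calc ((n + 1 : ℕ) : ℚ) * ((n + 1 : ℕ) - 1) / 2
            = n * ((n : ℚ) - 1) / 2 * (((n : ℚ) + 1) / (n + 1 - (2 : ℕ))) := by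
            have : (n : ℚ) - 1 ≠ 0 := by linarith
            have : (n : ℚ) + 1 - 2 ≠ 0 := by linarith
            push_cast
            field_simp
            ring
        _ ≤ _ := mul_le_mul (ih hkn h') h2
            (div_nonneg (by positivity) (by push_cast; linarith))
            (le_trans zero_le_one (one_le_slDim h'))
    · obtain rfl : k + 2 = n := by omega
      have h1 := le_slDim_of_step (by omega) h' hs
      have h2 := le_prod_slDim_factor (k := k + 1) (by omega)
        (fun i hi => h i _ hi.le (by omega)) hlast
      calc ((k + 2 + 1 : ℕ) : ℚ) * ((k + 2 + 1 : ℕ) - 1) / 2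
            = (k + 2 : ℕ) * ((((k + 2 : ℕ) : ℚ) + 1) / ((k + 2 : ℕ) + 1 - (k + 1 : ℕ))) := by
            push_cast
            ring
        _ ≤ _ := mul_le_mul h1 h2
            (div_nonneg (by positivity) (by push_cast; linarith))
            (le_trans zero_le_one (one_le_slDim h'))

lemma le_slDim_of_first_step_two {n : ℕ} (hn : 2 ≤ n) {β : ℕ → ℚ}
    (h : ∀ i j, i ≤ j → j < n → β j ≤ β i) (hs : β 1 + 2 ≤ β 0) :
    (n : ℚ) * (n + 1) / 2 ≤ slDim n β := by
  induction n, hn using Nat.le_induction with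
  | base =>
    simp [slDim_succ, slDim_zero]
    linarith
  | succ n hn ih =>
    rw [slDim_succ]
    have h' : ∀ i j, i ≤ j → j < n → β j ≤ β i := fun i j hij hj => h i j hij (by omega)
    have hn' : (2 : ℚ) ≤ n := by exact_mod_cast hn
    have hf : ((n : ℚ) + 2) / n ≤
        ∏ i ∈ Finset.range n, ((n : ℚ) - i + β i - β n) / ((n : ℚ) - i) := by
      obtain ⟨m, rfl⟩ : ∃ m, n = m + 1 := ⟨n - 1, by omega⟩
      rw [Finset.prod_range_succ']
      have h1 : (1 : ℚ) ≤ ∏ i ∈ Finset.range m, (((m + 1 : ℕ) : ℚ) - (i + 1 : ℕ) + β (i + 1)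
          - β (m + 1)) / (((m + 1 : ℕ) : ℚ) - (i + 1 : ℕ)) :=
        Finset.one_le_prod fun i hi => one_le_slDim_factor
          (by have := Finset.mem_range.1 hi; omega)
          (h _ _ (by have := Finset.mem_range.1 hi; omega) (by omega))
      have h2 : (((m + 1 : ℕ) : ℚ) + 2) / (m + 1 : ℕ) ≤
          (((m + 1 : ℕ) : ℚ) - (0 : ℕ) + β 0 - β (m + 1)) / (((m + 1 : ℕ) : ℚ) - (0 : ℕ)) := by
        rw [Nat.cast_zero, sub_zero]
        exact div_le_div_of_nonneg_right
          (by linarith [h 1 (m + 1) (by omega) (by omega)]) (by positivity)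
      exact h2.trans (le_mul_of_one_le_left (le_trans (by positivity) h2) h1)
    calc ((n + 1 : ℕ) : ℚ) * ((n + 1 : ℕ) + 1) / 2
          = n * ((n : ℚ) + 1) / 2 * (((n : ℚ) + 2) / n) := by
          push_cast
          field_simp
          ring
      _ ≤ _ := mul_le_mul (ih h') hf (by positivity) (le_trans zero_le_one (one_le_slDim h'))

lemma slDim_of_const {n : ℕ} {β : ℕ → ℚ} (h : ∀ i < n, β i = β 0) : slDim n β = 1 := by
  induction n with
  | zero => exact slDim_zero β
  | succ n ih =>
    rw [slDim_succ, ih fun i hi => h i (by omega), one_mul]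
    refine Finset.prod_eq_one fun i hi => ?_
    have hi := Finset.mem_range.1 hi
    have : (i : ℚ) < n := by exact_mod_cast hi
    rw [h i (by omega), h n (by omega), add_sub_cancel_right, div_self (by linarith)]

lemma slDim_one_one {n : ℕ} (hn : 2 ≤ n) : slDim n (lw [1, 1]) = (n : ℚ) * (n - 1) / 2 := by
  induction n, hn using Nat.le_induction with
  | base => norm_num [slDim_succ, slDim_zero, lw]
  | succ n hn ih =>
    rw [slDim_succ, ih]
    obtain ⟨m, rfl⟩ : ∃ m, n = m + 2 := ⟨n - 2, by omega⟩
    rw [Finset.prod_range_succ', Finset.prod_range_succ', Finset.prod_eq_one]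
    · have : (m : ℚ) + 2 - 1 ≠ 0 := by
        have : (0 : ℚ) ≤ m := by positivity
        linarith
      simp [lw]
      field_simp
    · intro i hi
      have : (i : ℚ) < m := by exact_mod_cast Finset.mem_range.1 hi
      have h0 : (m : ℚ) + 2 - (i + 1 + 1) ≠ 0 := by linarith
      simp [lw, h0]

lemma slDim_four (β : ℕ → ℚ) : slDim 4 β =
    (1 + β 0 - β 1) * (1 + β 1 - β 2) * (1 + β 2 - β 3) * ((2 + β 0 - β 2) / 2) *
      ((2 + β 1 - β 3) / 2) * ((3 + β 0 - β 3) / 3) := by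
  norm_num [slDim_succ, slDim_zero, Finset.prod_range_succ]
  ring

/-- The weight with all `n` entries equal to `c`. -/
def constWeight (n : ℕ) (c : ℚ) : ℕ → ℚ := fun i => if i < n then c else 0

lemma constWeight_eq_lw (n : ℕ) (c : ℚ) : constWeight n c = lw (List.replicate n c) := by
  funext i
  by_cases h : i < n <;> simp [constWeight, lw, List.getD_eq_getElem?_getD, h]

lemma le_headSum {n k : ℕ} (hk : k ≤ n) {β : ℕ → ℚ} {c : ℚ} (h0 : ∀ i < n, 0 ≤ β i)
    (hc : ∀ i < k, c ≤ β i) : k * c ≤ headSum n β := by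
  calc (k : ℚ) * c = ∑ _i ∈ Finset.range k, c := by simp
    _ ≤ ∑ i ∈ Finset.range k, β i := Finset.sum_le_sum fun i hi => hc i (Finset.mem_range.1 hi)
    _ ≤ headSum n β := Finset.sum_le_sum_of_subset_of_nonneg (Finset.range_subset_range.2 hk)
        fun i hi _ => h0 i (Finset.mem_range.1 hi)

lemma headSum_of_const {n : ℕ} {β : ℕ → ℚ} (h : ∀ i < n, β i = β 0) :
    headSum n β = n * β 0 := by
  rw [headSum, Finset.sum_congr rfl fun i hi => h i (Finset.mem_range.1 hi)]
  simp

lemma headSum_one_one {n : ℕ} (hn : 2 ≤ n) : headSum n (lw [1, 1]) = 2 := by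
  obtain ⟨m, rfl⟩ : ∃ m, n = m + 2 := ⟨n - 2, by omega⟩
  rw [headSum, Finset.sum_range_succ', Finset.sum_range_succ', Finset.sum_eq_zero]
  · norm_num [lw]
  · intro i _
    simp [lw]

namespace IsOGrOddWeight

variable {n : ℕ} {β : ℕ → ℚ}

lemma antitone (h : IsOGrOddWeight n β) : ∀ i j, i ≤ j → j < n → β j ≤ β i := h.2.1

lemma eq_or_step (h : IsOGrOddWeight n β) {i j : ℕ} (hij : i ≤ j) (hj : j < n) :
    β i = β j ∨ β j + 1 ≤ β i := by
  have hle := h.2.1 i j hij hj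
  have key : ∀ y z : ℤ, ∀ c : ℚ, β i = y + c → β j = z + c → β i = β j ∨ β j + 1 ≤ β i := by
    intro y z c hy hz
    have hzy : (z : ℚ) ≤ y := by linarith
    have hzy : z ≤ y := by exact_mod_cast hzy
    rcases hzy.eq_or_lt with rfl | hlt
    · exact Or.inl (by rw [hy, hz])
    · have : (z : ℚ) + 1 ≤ y := by exact_mod_cast hlt
      exact Or.inr (by linarith)
  rcases h.1 with hi | hi
  · obtain ⟨y, hy⟩ := hi i (by omega)
    obtain ⟨z, hz⟩ := hi j hj
    exact key y z 0 (by rw [hy, add_zero]) (by rw [hz, add_zero])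
  · obtain ⟨y, hy⟩ := hi i (by omega)
    obtain ⟨z, hz⟩ := hi j hj
    exact key y z _ hy hz

lemma exists_eq_half (h : IsOGrOddWeight n β) {i : ℕ} (hi : i < n) : ∃ p : ℕ, β i = p / 2 := by
  have h0 := h.2.2.1 i hi
  obtain ⟨z, hz⟩ : ∃ z : ℤ, β i = z / 2 := by
    rcases h.1 with h | h
    · obtain ⟨z, hz⟩ := h i hi
      exact ⟨2 * z, by rw [hz]; push_cast; ring⟩
    · obtain ⟨z, hz⟩ := h i hi
      exact ⟨2 * z + 1, by rw [hz]; push_cast; ring⟩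
  have : (0 : ℚ) ≤ z := by linarith
  obtain ⟨p, rfl⟩ := Int.eq_ofNat_of_zero_le (by exact_mod_cast this : 0 ≤ z)
  exact ⟨p, by simpa using hz⟩

lemma eq_zero_or_one_le_or_half (h : IsOGrOddWeight n β) {i : ℕ} (hi : i < n) :
    β i = 0 ∨ β i = 1 / 2 ∨ 1 ≤ β i := by
  obtain ⟨p, hp⟩ := h.exists_eq_half hi
  rw [hp]
  rcases p with _ | _ | p
  · simp
  · simp
  · right; right
    push_cast
    have : (0 : ℚ) ≤ p := by positivity
    linarith

lemma eq_constWeight (h : IsOGrOddWeight n β) (hc : ∀ i < n, β i = β 0) :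
    β = constWeight n (β 0) := by
  funext i
  by_cases hi : i < n
  · simp [constWeight, hi, hc i hi]
  · simp [constWeight, hi, h.2.2.2 i (by omega)]

lemma half_or_one_le (h : IsOGrOddWeight n β) (hn : 0 < n) (h0 : β ≠ 0)
    (hc : ∀ i < n, β i = β 0) : β 0 = 1 / 2 ∨ 1 ≤ β 0 := by
  rcases h.eq_zero_or_one_le_or_half hn with h1 | h1 | h1
  · refine absurd ?_ h0
    rw [h.eq_constWeight hc, h1]
    funext i
    simp [constWeight]
  · exact Or.inl h1
  · exact Or.inr h1

lemma const_or_exists_step (h : IsOGrOddWeight n β) :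
    (∀ i < n, β i = β 0) ∨ ∃ k, k + 1 < n ∧ β (k + 1) + 1 ≤ β k := by
  by_contra! hcon
  obtain ⟨⟨i, hi, hne⟩, hs⟩ := hcon
  refine hne ?_
  clear hne
  induction i with
  | zero => rfl
  | succ i ih =>
    rw [← ih (by omega)]
    rcases h.eq_or_step (Nat.le_succ i) hi with h1 | h1
    · exact h1.symm
    · exact absurd h1 (not_le.2 (hs i hi))

lemma const_or_le_slDim (h : IsOGrOddWeight n β) :
    (∀ i < n, β i = β 0) ∨ (n : ℚ) ≤ slDim n β := by
  rcases h.const_or_exists_step with h1 | ⟨k, hk, hs⟩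
  · exact Or.inl h1
  · exact Or.inr (le_slDim_of_step hk h.antitone hs)

lemma headSum_nonneg (h : IsOGrOddWeight n β) : 0 ≤ headSum n β :=
  Finset.sum_nonneg fun i hi => h.2.2.1 i (Finset.mem_range.1 hi)

lemma slDim_nonneg (h : IsOGrOddWeight n β) : 0 ≤ slDim n β :=
  zero_le_one.trans (one_le_slDim h.antitone)

lemma dex_nonneg (h : IsOGrOddWeight n β) : 0 ≤ headSum n β / n * slDim n β :=
  mul_nonneg (div_nonneg h.headSum_nonneg (by positivity)) h.slDim_nonneg

lemma dex_of_const (hn : 0 < n) (hc : ∀ i < n, β i = β 0) :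
    headSum n β / n * slDim n β = β 0 := by
  have : (n : ℚ) ≠ 0 := by positivity
  rw [slDim_of_const hc, headSum_of_const hc, mul_one, mul_div_cancel_left₀ _ this]

/-- The non-constant weights for `n = 4` of small rank and degree. -/
lemma four_cases (h : IsOGrOddWeight 4 β) (h1 : β ≠ lw [1])
    (hd : headSum 4 β / (4 : ℕ) * slDim 4 β ≤ 4) :
    (∀ i < 4, β i = β 0) ∨ 6 ≤ slDim 4 β ∨
      ((β = lw [1, 1, 1] ∨ β = lw [3/2, 1/2, 1/2, 1/2]) ∧ slDim 4 β = 4 ∧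
        headSum 4 β / (4 : ℕ) * slDim 4 β = 3) := by
  have ext : ∀ a b c d : ℚ, β 0 = a → β 1 = b → β 2 = c → β 3 = d → β = lw [a, b, c, d] := by
    rintro a b c d rfl rfl rfl rfl
    funext i
    rcases i with _ | _ | _ | _ | i <;> simp [lw, h.2.2.2]
  have hsum : headSum 4 β = β 0 + β 1 + β 2 + β 3 := by simp [headSum, Finset.sum_range_succ]
  rcases h.eq_or_step (i := 1) (j := 2) (by omega) (by omega) with e12 | s
  swap
  · have := le_slDim_of_interior_step (k := 1) le_rfl (by omega) h.antitone s
    norm_num at this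
    exact Or.inr (Or.inl this)
  have h01 := h.antitone 0 1 (by omega) (by omega)
  have h23 := h.antitone 2 3 (by omega) (by omega)
  have hbig : ∀ x y : ℚ, 0 ≤ x → 0 ≤ y →
      (β 0 = β 1 + 2 + x ∧ β 3 = β 1 - y ∨ β 0 = β 1 + x ∧ β 3 = β 1 - (2 + y) ∨
        β 0 = β 1 + 1 + x ∧ β 3 = β 1 - (1 + y)) → 6 ≤ slDim 4 β := by
    intro x y hx hy hxy
    rw [← sub_nonneg, slDim_four, ← e12]
    rcases hxy with ⟨e0, e3⟩ | ⟨e0, e3⟩ | ⟨e0, e3⟩ <;> rw [e0, e3] <;> ring_nf <;> positivity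
  have two : ∀ i j, i ≤ j → j < 4 → β j + 1 ≤ β i → β i = β j + 1 ∨ β j + 2 ≤ β i := by
    intro i j hij hj hs
    rcases h.1 with hi | hi
    all_goals
      obtain ⟨y, hy⟩ := hi i (by omega)
      obtain ⟨z, hz⟩ := hi j hj
      rw [hy, hz] at hs ⊢
      have h1 : (z : ℚ) + 1 ≤ y := by linarith
      have h1 : z + 1 ≤ y := by exact_mod_cast h1
      rcases h1.eq_or_lt with rfl | hlt
      · left; push_cast; ring
      · have h2 : ((z + 1 + 1 : ℤ) : ℚ) ≤ y := by exact_mod_cast hlt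
        right; push_cast at h2; linarith
  rcases h.eq_or_step (i := 0) (j := 1) (by omega) (by omega) with e01 | s01 <;>
    rcases h.eq_or_step (i := 2) (j := 3) (by omega) (by omega) with e23 | s23
  · left
    intro i hi
    interval_cases i
    · rfl
    · exact e01.symm
    · rw [← e12, e01]
    · rw [← e23, ← e12, e01]
  · rcases two 2 3 (by omega) (by omega) s23 with t | t
    · right; right
      have hD : slDim 4 β = 4 := by
        rw [slDim_four, e01, e12, t]
        ring
      rw [hD, hsum, e01, e12, t] at hd
      have e3 : β 3 = 0 := by
        rcases h.eq_zero_or_one_le_or_half (i := 3) (by omega) with h3 | h3 | h3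
        · exact h3
        · rw [h3] at hd
          norm_num at hd
        · push_cast at hd
          linarith
      refine ⟨Or.inl ?_, hD, ?_⟩
      · rw [ext 1 1 1 0 (by linarith) (by linarith) (by linarith) e3]
        funext i
        rcases i with _ | _ | _ | _ | i <;> simp [lw]
      · rw [hD, hsum, e01, e12, t, e3]
        norm_num
    · exact Or.inr (Or.inl (hbig (β 0 - β 1) (β 2 - β 3 - 2) (by linarith) (by linarith)
        (Or.inr (Or.inl ⟨by linarith, by linarith⟩))))
  · rcases two 0 1 (by omega) (by omega) s01 with t | t
    · right; right
      have hD : slDim 4 β = 4 := by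
        rw [slDim_four, t, e12, e23]
        ring
      rw [hD, hsum, t, e12, e23] at hd
      rcases h.eq_zero_or_one_le_or_half (i := 3) (by omega) with h3 | h3 | h3
      · refine absurd ?_ h1
        rw [ext 1 0 0 0 (by linarith) (by linarith) (by linarith) h3]
        funext i
        rcases i with _ | _ | _ | _ | i <;> simp [lw]
      · refine ⟨Or.inr (ext _ _ _ _ (by linarith) (by linarith) (by linarith) h3), hD, ?_⟩
        rw [hD, hsum, t, e12, e23, h3]
        norm_num
      · push_cast at hd
        linarith
    · exact Or.inr (Or.inl (hbig (β 0 - β 1 - 2) (β 2 - β 3) (by linarith) (by linarith)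
        (Or.inl ⟨by linarith, by linarith⟩)))
  · exact Or.inr (Or.inl (hbig (β 0 - β 1 - 1) (β 2 - β 3 - 1) (by linarith) (by linarith)
      (Or.inr (Or.inr ⟨by linarith, by linarith⟩))))

/-- For `n ≥ 5`, the only weight of slope less than `1/2` with small rank and degree. -/
lemma eq_one_one_of_slope_lt (h : IsOGrOddWeight n β) (hn : 5 ≤ n) (h0 : β ≠ 0)
    (h1 : β ≠ lw [1]) (hs : headSum n β < n / 2)
    (hD : slDim n β < (n : ℚ) * (n + 1) / 2)
    (hd : headSum n β / n * slDim n β ≤ n) : β = lw [1, 1] := by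
  have hnQ : (5 : ℚ) ≤ n := by exact_mod_cast hn
  have hpos := h.2.2.1
  have hint : ∀ i < n, β i = 0 ∨ 1 ≤ β i := by
    rcases h.1 with hi | hi
    · intro i hin
      obtain ⟨z, hz⟩ := hi i hin
      have hp := hpos i hin
      rw [hz] at hp ⊢
      have hp : 0 ≤ z := by exact_mod_cast hp
      rcases hp.eq_or_lt with rfl | hlt
      · simp
      · right; exact_mod_cast hlt
    · have := le_headSum (k := n) le_rfl hpos (c := 1 / 2) fun i hin => by
        obtain ⟨z, hz⟩ := hi i hin
        have hp := hpos i hin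
        rw [hz] at hp ⊢
        have hp : (-1 : ℚ) < z := by linarith
        have hp : -1 < z := by exact_mod_cast hp
        have hp : (0 : ℚ) ≤ z := by exact_mod_cast (by omega : 0 ≤ z)
        linarith
      linarith
  have hzero : ∀ k i, β k = 0 → k ≤ i → i < n → β i = 0 := fun k i hk hki hi =>
    le_antisymm (hk ▸ h.antitone k i hki hi) (hpos i hi)
  have hlast : β (n - 2) = 0 := by
    rcases hint (n - 2) (by omega) with h2 | h2
    · exact h2
    · have := le_headSum (k := n - 1) (by omega) hpos (c := 1) fun i hi =>
        h2.trans (h.antitone i (n - 2) (by omega) (by omega))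
      rw [Nat.cast_sub (by omega)] at this
      push_cast at this
      linarith
  have hβ1 : 1 ≤ β 1 := by
    rcases hint 1 (by omega) with h2 | h2
    swap
    · exact h2
    exfalso
    have ext : ∀ c, β 0 = c → β = lw [c] := by
      rintro c rfl
      funext i
      rcases i with _ | i
      · simp [lw]
      · rcases lt_or_ge (i + 1) n with hi | hi
        · simp [lw, hzero 1 (i + 1) h2 (by omega) hi]
        · simp [lw, h.2.2.2 _ hi]
    have hβ0 : β 1 + 2 ≤ β 0 := by
      rcases h.eq_or_step (i := 0) (j := 1) (by omega) (by omega) with e | e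
      · refine absurd ?_ h0
        rw [ext 0 (e.trans h2)]
        funext i
        rcases i with _ | i <;> simp [lw]
      · by_contra! hlt
        obtain hi | hi := h.1
        · obtain ⟨z, hz⟩ := hi 0 (by omega)
          rw [h2, hz] at hlt e
          have hz2 : z < 2 := by exact_mod_cast (by linarith : (z : ℚ) < 2)
          have hz1 : 1 ≤ z := by exact_mod_cast (by linarith : (1 : ℚ) ≤ z)
          obtain rfl : z = 1 := by omega
          exact h1 (ext 1 (by simpa using hz))
        · obtain ⟨z, hz⟩ := hi 1 (by omega)
          rw [h2] at hz
          have : (2 * z + 1 : ℚ) = 0 := by linarith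
          have : 2 * z + 1 = 0 := by exact_mod_cast this
          omega
    exact absurd (le_slDim_of_first_step_two (by omega) h.antitone hβ0) (not_le.2 hD)
  obtain ⟨k, hk1, hk, hstep⟩ : ∃ k, 1 ≤ k ∧ k + 2 < n ∧ β (k + 1) + 1 ≤ β k := by
    by_contra! hcon
    have : ∀ k, 1 ≤ k → k ≤ n - 2 → β k = β 1 := by
      intro k hk
      induction k, hk using Nat.le_induction with
      | base => exact fun _ => rfl
      | succ k hk ih =>
        intro hkn
        rw [← ih (by omega)]
        rcases h.eq_or_step (Nat.le_succ k) (by omega) with e | e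
        · exact e.symm
        · exact absurd e (not_le.2 (hcon k hk (by omega)))
    linarith [this (n - 2) (by omega) le_rfl]
  have hDlow := le_slDim_of_interior_step hk1 hk h.antitone hstep
  have hsum3 : headSum n β < 3 := by
    by_contra! hge
    have h3 : 3 / (n : ℚ) * (n * (n - 1) / 2) ≤ headSum n β / n * slDim n β :=
      mul_le_mul (div_le_div_of_nonneg_right hge (by linarith)) hDlow
        (by nlinarith) (div_nonneg (by linarith) (by linarith))
    have h4 : 3 / (n : ℚ) * (n * (n - 1) / 2) = 3 * (n - 1) / 2 := by field_simp
    linarith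
  have hthree : β 0 + β 1 + β 2 ≤ headSum n β := by
    have : ∑ i ∈ Finset.range 3, β i ≤ headSum n β :=
      Finset.sum_le_sum_of_subset_of_nonneg (Finset.range_subset_range.2 (by omega))
        fun i hi _ => hpos i (Finset.mem_range.1 hi)
    simpa [Finset.sum_range_succ] using this
  have h01 := h.antitone 0 1 (by omega) (by omega)
  have h2 : β 2 = 0 := by
    rcases hint 2 (by omega) with e | e
    · exact e
    · linarith
  have e12 : β 1 = 1 := by
    rcases h.eq_or_step (i := 1) (j := 2) (by omega) (by omega) with e | e
    · linarith
    · rcases h.1 with hi | hi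
      · obtain ⟨z, hz⟩ := hi 1 (by omega)
        have hz2 : z < 2 := by exact_mod_cast (by linarith : (z : ℚ) < 2)
        have hz1 : 1 ≤ z := by exact_mod_cast (by linarith : (1 : ℚ) ≤ z)
        obtain rfl : z = 1 := by omega
        simpa using hz
      · obtain ⟨z, hz⟩ := hi 2 (by omega)
        rw [h2] at hz
        have : (2 * z + 1 : ℚ) = 0 := by linarith
        have : 2 * z + 1 = 0 := by exact_mod_cast this
        omega
  have e01 : β 0 = 1 := by
    rcases h.eq_or_step (i := 0) (j := 1) (by omega) (by omega) with e | e
    · rw [e, e12]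
    · linarith
  funext i
  rcases i with _ | _ | i
  · simpa [lw] using e01
  · simpa [lw] using e12
  · rcases lt_or_ge (i + 2) n with hi | hi
    · simp [lw, hzero 2 (i + 2) h2 (by omega) hi]
    · simp [lw, h.2.2.2 _ hi]

end IsOGrOddWeight

section Multiset

variable {α : Type*}

lemma sum_map_nonneg_of_mem {M : Multiset α} {f : α → ℚ} (h : ∀ x ∈ M, 0 ≤ f x) :
    0 ≤ (M.map f).sum :=
  Multiset.sum_nonneg fun y hy => by
    obtain ⟨x, hx, rfl⟩ := Multiset.mem_map.1 hy
    exact h x hx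

lemma le_sum_map_of_mem {M : Multiset α} {f : α → ℚ} (h : ∀ x ∈ M, 0 ≤ f x) {x : α}
    (hx : x ∈ M) : f x ≤ (M.map f).sum := by
  obtain ⟨t, rfl⟩ := Multiset.exists_cons_of_mem hx
  have := sum_map_nonneg_of_mem fun y hy => h y (Multiset.mem_cons_of_mem hy)
  rw [Multiset.map_cons, Multiset.sum_cons]
  linarith

lemma card_mul_le_sum_map {M : Multiset α} {f : α → ℚ} {a : ℚ} (h : ∀ x ∈ M, a ≤ f x) :
    Multiset.card M * a ≤ (M.map f).sum := by
  have := Multiset.card_nsmul_le_sum (s := M.map f) (a := a) fun y hy => by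
    obtain ⟨x, hx, rfl⟩ := Multiset.mem_map.1 hy
    exact h x hx
  simpa using this

lemma sum_map_eq_card {M : Multiset α} {f : α → ℚ} (h : ∀ x ∈ M, f x = 1) :
    (M.map f).sum = Multiset.card M := by
  rw [Multiset.map_congr rfl h]
  simp

lemma eq_of_sum_map_le {M : Multiset α} {f : α → ℚ} {a : ℚ} (h : ∀ x ∈ M, a ≤ f x)
    (hs : (M.map f).sum ≤ Multiset.card M * a) : ∀ x ∈ M, f x = a := by
  intro x hx
  obtain ⟨t, rfl⟩ := Multiset.exists_cons_of_mem hx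
  have := card_mul_le_sum_map fun y hy => h y (Multiset.mem_cons_of_mem hy)
  rw [Multiset.map_cons, Multiset.sum_cons, Multiset.card_cons] at hs
  push_cast at hs
  linarith [h x hx]

end Multiset

/-- All members of the collection are weights with equal entries. -/
def AllConst (n : ℕ) (M : Multiset (ℕ → ℚ)) : Prop :=
  ∀ β ∈ M, IsOGrOddWeight n β ∧ β ≠ 0 ∧ ∀ i < n, β i = β 0

namespace AllConst

variable {n : ℕ} {M : Multiset (ℕ → ℚ)}

lemma sum_slDim (h : AllConst n M) : (M.map (slDim n)).sum = Multiset.card M :=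
  sum_map_eq_card fun β hβ => slDim_of_const (h β hβ).2.2

lemma sum_dex (h : AllConst n M) (hn : 0 < n) :
    (M.map fun β => headSum n β / n * slDim n β).sum = (M.map fun β => β 0).sum := by
  rw [Multiset.map_congr rfl fun β hβ => IsOGrOddWeight.dex_of_const hn (h β hβ).2.2]

lemma of_cons {β : ℕ → ℚ} (h : AllConst n (β ::ₘ M)) : AllConst n M :=
  fun γ hγ => h γ (Multiset.mem_cons_of_mem hγ)

lemma half_le (h : AllConst n M) (hn : 0 < n) : ∀ β ∈ M, 1 / 2 ≤ β 0 := by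
  intro β hβ
  obtain ⟨hw, h0, hc⟩ := h β hβ
  rcases hw.half_or_one_le hn h0 hc with e | e
  · exact e.ge
  · linarith

lemma card_mul_half_le_sum (h : AllConst n M) (hn : 0 < n) :
    Multiset.card M * (1 / 2 : ℚ) ≤ (M.map fun β => β 0).sum :=
  card_mul_le_sum_map (h.half_le hn)

lemma eq_replicate (h : AllConst n M) (hn : 0 < n)
    (hs : (M.map fun β => β 0).sum ≤ Multiset.card M * (1 / 2 : ℚ)) :
    M = Multiset.replicate (Multiset.card M) (constWeight n (1 / 2)) := by
  refine Multiset.eq_replicate.2 ⟨rfl, fun β hβ => ?_⟩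
  obtain ⟨hw, -, hc⟩ := h β hβ
  rw [hw.eq_constWeight hc, eq_of_sum_map_le (f := fun β : ℕ → ℚ => β 0) (h.half_le hn) hs β hβ]

/-- If the degree exceeds the minimum, some entry is at least `1`. -/
lemma exists_cons (h : AllConst n M) (hn : 0 < n)
    (hs : Multiset.card M * (1 / 2 : ℚ) < (M.map fun β => β 0).sum) :
    ∃ c T, 1 ≤ c ∧ M = constWeight n c ::ₘ T ∧ (∃ p : ℕ, c = p / 2) ∧
      (M.map fun β => β 0).sum = c + (T.map fun β => β 0).sum := by
  obtain ⟨β, hβ, hβ1⟩ : ∃ β ∈ M, 1 ≤ β 0 := by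
    by_contra! hcon
    have e : ∀ β ∈ M, β 0 = 1 / 2 := fun β hβ => by
      obtain ⟨hw, h0, hc⟩ := h β hβ
      rcases hw.half_or_one_le hn h0 hc with e | e
      · exact e
      · exact absurd e (not_le.2 (hcon β hβ))
    rw [Multiset.map_congr rfl e] at hs
    simp at hs
  obtain ⟨T, rfl⟩ := Multiset.exists_cons_of_mem hβ
  obtain ⟨hw, -, hc⟩ := h β hβ
  refine ⟨β 0, T, hβ1, ?_, hw.exists_eq_half hn, by simp⟩
  rw [← hw.eq_constWeight hc]

end AllConst

/-- A collection of total rank `2` and total degree `1`. -/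
lemma eq_half_pair {n : ℕ} (hn : 3 ≤ n) {M : Multiset (ℕ → ℚ)}
    (hw : ∀ β ∈ M, IsOGrOddWeight n β ∧ β ≠ 0) (hr : (M.map (slDim n)).sum = 2)
    (hd : (M.map fun β => headSum n β / n * slDim n β).sum = 1) :
    M = {constWeight n (1 / 2), constWeight n (1 / 2)} := by
  have hnQ : (3 : ℚ) ≤ n := by exact_mod_cast hn
  have hM : AllConst n M := fun β hβ => by
    refine ⟨(hw β hβ).1, (hw β hβ).2, ?_⟩
    rcases (hw β hβ).1.const_or_le_slDim with hc | hc
    · exact hc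
    · linarith [le_sum_map_of_mem (fun γ hγ => (hw γ hγ).1.slDim_nonneg) hβ]
  rw [hM.sum_slDim] at hr
  rw [hM.sum_dex (by omega)] at hd
  have hcard : Multiset.card M = 2 := by exact_mod_cast hr
  rw [hM.eq_replicate (by omega) (by rw [hr, hd]; norm_num), hcard]
  rfl

lemma classification_three (S : Multiset (ℕ → ℚ))
    (hw : ∀ β ∈ S, IsOGrOddWeight 3 β ∧ β ≠ 0)
    (hnew : ∃ β ∈ S, ∃ i, i < 3 ∧ ∀ z : ℤ, β i ≠ (z : ℚ))
    (hr : (S.map (slDim 3)).sum = 2)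
    (hd : (S.map (fun β => headSum 3 β / (3 : ℕ) * slDim 3 β)).sum = 3) :
    S = {constWeight 3 (1 / 2), constWeight 3 (5 / 2)} ∨
      S = {constWeight 3 (3 / 2), constWeight 3 (3 / 2)} := by
  have hS : AllConst 3 S := fun β hβ => by
    refine ⟨(hw β hβ).1, (hw β hβ).2, ?_⟩
    rcases (hw β hβ).1.const_or_le_slDim with hc | hc
    · exact hc
    · have := le_sum_map_of_mem (fun γ hγ => (hw γ hγ).1.slDim_nonneg) hβ
      push_cast at hc
      linarith
  rw [hS.sum_slDim] at hr
  rw [hS.sum_dex (by omega)] at hd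
  obtain ⟨β, hβ, i, hi, hz⟩ := hnew
  obtain ⟨T, rfl⟩ := Multiset.exists_cons_of_mem hβ
  have hcard : Multiset.card T = 1 := by
    have : Multiset.card (β ::ₘ T) = 2 := by exact_mod_cast hr
    simpa using this
  obtain ⟨γ, rfl⟩ := Multiset.card_eq_one.1 hcard
  have hγ : γ ∈ β ::ₘ {γ} := by simp
  obtain ⟨wβ, -, cβ⟩ := hS β hβ
  obtain ⟨wγ, -, cγ⟩ := hS γ hγ
  have gβ := hS.half_le (by omega) β hβ
  have gγ := hS.half_le (by omega) γ hγ
  simp only [Multiset.map_cons, Multiset.sum_cons, Multiset.map_singleton,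
    Multiset.sum_singleton] at hd
  rw [cβ i hi] at hz
  rw [wβ.eq_constWeight cβ, wγ.eq_constWeight cγ]
  obtain ⟨p, hp⟩ := wβ.exists_eq_half (i := 0) (by omega)
  have eγ : γ 0 = 3 - β 0 := by linarith
  have hp5 : p ≤ 5 := by
    have : (p : ℚ) ≤ 5 := by linarith
    exact_mod_cast this
  rw [eγ]
  interval_cases p
  · norm_num [hp] at gβ
  · left
    norm_num [hp]
  · exact absurd (by norm_num [hp]) (hz 1)
  · right
    norm_num [hp]
  · exact absurd (by norm_num [hp]) (hz 2)
  · left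
    norm_num [hp]
    exact Multiset.pair_comm _ _

lemma cons_pair_eq {α : Type*} (a b c : α) : a ::ₘ ({b, c} : Multiset α) = {b, c, a} := by
  simp only [Multiset.insert_eq_cons]
  rw [Multiset.cons_swap]
  congr 1
  exact Multiset.pair_comm _ _

lemma classification_four (S : Multiset (ℕ → ℚ))
    (hw : ∀ β ∈ S, IsOGrOddWeight 4 β ∧ β ≠ 0 ∧ β ≠ lw [1])
    (hr : (S.map (slDim 4)).sum = 6)
    (hd : (S.map (fun β => headSum 4 β / (4 : ℕ) * slDim 4 β)).sum = 4) :
    S = {constWeight 4 (1 / 2), constWeight 4 (1 / 2), lw [1, 1, 1]} ∨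
    S = {constWeight 4 (1 / 2), constWeight 4 (1 / 2), lw [3/2, 1/2, 1/2, 1/2]} ∨
    S = Multiset.replicate 5 (constWeight 4 (1 / 2)) + {constWeight 4 (3 / 2)} ∨
    S = Multiset.replicate 4 (constWeight 4 (1 / 2)) + {constWeight 4 1, constWeight 4 1} := by
  by_cases hS : ∀ β ∈ S, ∀ i < 4, β i = β 0
  · have hS : AllConst 4 S := fun β hβ => ⟨(hw β hβ).1, (hw β hβ).2.1, hS β hβ⟩
    rw [hS.sum_slDim] at hr
    rw [hS.sum_dex (by omega)] at hd
    obtain ⟨c, T, hc1, rfl, ⟨p, hp⟩, hs⟩ := hS.exists_cons (by omega) (by rw [hr, hd]; norm_num)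
    have hT := hS.of_cons
    have hcT : (Multiset.card T : ℚ) = 5 := by
      rw [Multiset.card_cons] at hr
      push_cast at hr
      linarith
    have hT5 : Multiset.card T = 5 := by exact_mod_cast hcT
    have hTle := hT.card_mul_half_le_sum (by omega)
    rw [hcT] at hTle
    have hp3 : p ≤ 3 := by
      have : (p : ℚ) ≤ 3 := by linarith
      exact_mod_cast this
    have hp2 : 2 ≤ p := by
      have : (2 : ℚ) ≤ p := by linarith
      exact_mod_cast this
    right; right
    interval_cases p
    · right
      obtain ⟨d, U, hd1, rfl, -, hs'⟩ :=
        hT.exists_cons (by omega) (by rw [hcT]; norm_num at hp; linarith)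
      have hU := hT.of_cons
      have hcU : (Multiset.card U : ℚ) = 4 := by
        rw [Multiset.card_cons] at hcT
        push_cast at hcT
        linarith
      have hU4 : Multiset.card U = 4 := by exact_mod_cast hcU
      have hUle := hU.card_mul_half_le_sum (by omega)
      rw [hcU] at hUle
      norm_num at hp
      have hd1 : d = 1 := by linarith
      rw [hU.eq_replicate (by omega) (by rw [hcU]; linarith), hU4, hp, hd1, add_comm]
      rfl
    · left
      norm_num at hp
      rw [hT.eq_replicate (by omega) (by rw [hcT]; linarith), hT5, hp, add_comm]
      rfl
  · push Not at hS
    obtain ⟨β, hβ, i, hi, hne⟩ := hS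
    have hdle := le_sum_map_of_mem (fun γ hγ => (hw γ hγ).1.dex_nonneg) hβ
    rw [hd] at hdle
    obtain ⟨T, rfl⟩ := Multiset.exists_cons_of_mem hβ
    rw [Multiset.map_cons, Multiset.sum_cons] at hr hd
    have hT : ∀ γ ∈ T, IsOGrOddWeight 4 γ ∧ γ ≠ 0 := fun γ hγ =>
      have := hw γ (Multiset.mem_cons_of_mem hγ)
      ⟨this.1, this.2.1⟩
    rcases (hw β hβ).1.four_cases (hw β hβ).2.2 hdle with hc | h6 | ⟨hβ', hD, hH⟩
    · exact absurd (hc i hi) hne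
    · exfalso
      have hc := card_mul_le_sum_map (f := slDim 4) (a := 1)
        fun γ hγ => one_le_slDim (hT γ hγ).1.antitone
      have hcard : Multiset.card T = 0 := by
        have h1 : (Multiset.card T : ℚ) ≤ 0 := by linarith
        have h1 : Multiset.card T ≤ 0 := by exact_mod_cast h1
        omega
      obtain rfl := Multiset.card_eq_zero.1 hcard
      simp only [Multiset.map_zero, Multiset.sum_zero, add_zero] at hr hd
      rw [hr] at hd
      obtain ⟨p0, e0⟩ := (hw β hβ).1.exists_eq_half (i := 0) (by omega)
      obtain ⟨p1, e1⟩ := (hw β hβ).1.exists_eq_half (i := 1) (by omega)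
      obtain ⟨p2, e2⟩ := (hw β hβ).1.exists_eq_half (i := 2) (by omega)
      obtain ⟨p3, e3⟩ := (hw β hβ).1.exists_eq_half (i := 3) (by omega)
      simp only [headSum, Finset.sum_range_succ, Finset.sum_range_zero, e0, e1, e2, e3] at hd
      have : (3 * (p0 + p1 + p2 + p3) : ℚ) = 16 := by
        push_cast at hd
        linarith
      have : 3 * (p0 + p1 + p2 + p3) = 16 := by exact_mod_cast this
      omega
    · rw [eq_half_pair (by norm_num) hT (by linarith) (by linarith), cons_pair_eq]
      rcases hβ' with rfl | rfl
      · exact Or.inl rfl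
      · exact Or.inr (Or.inl rfl)

lemma classification_of_five_le {n : ℕ} (hn : 5 ≤ n) (S : Multiset (ℕ → ℚ))
    (hw : ∀ β ∈ S, IsOGrOddWeight n β ∧ β ≠ 0 ∧ β ≠ lw [1])
    (hnew : ∃ β ∈ S, ∃ i, i < n ∧ ∀ z : ℤ, β i ≠ (z : ℚ))
    (hr : (S.map (slDim n)).sum = (n : ℚ) * ((n : ℚ) + 1) / 2 - 4)
    (hd : (S.map (fun β => headSum n β / (n : ℚ) * slDim n β)).sum = (n : ℚ)) :
    n = 6 ∧ S = {constWeight n (1 / 2), constWeight n (1 / 2), lw [1, 1]} := by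
  have hnQ : (5 : ℚ) ≤ n := by exact_mod_cast hn
  have hslope : ∀ β ∈ S, β ≠ lw [1, 1] →
      slDim n β ≤ 2 * (headSum n β / n * slDim n β) := by
    intro β hβ hne
    obtain ⟨hβw, h0, h1⟩ := hw β hβ
    have hD := le_sum_map_of_mem (fun γ hγ => (hw γ hγ).1.slDim_nonneg) hβ
    have hH := le_sum_map_of_mem (fun γ hγ => (hw γ hγ).1.dex_nonneg) hβ
    rw [hr] at hD
    rw [hd] at hH
    have hge : (n : ℚ) / 2 ≤ headSum n β := by
      by_contra! hlt
      exact hne (hβw.eq_one_one_of_slope_lt hn h0 h1 hlt (by linarith) hH)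
    have h2 : 1 / 2 ≤ headSum n β / n := by
      rw [le_div_iff₀ (by linarith)]
      linarith
    nlinarith [hβw.slDim_nonneg]
  have hsum : ∀ T : Multiset (ℕ → ℚ), (∀ β ∈ T, β ∈ S ∧ β ≠ lw [1, 1]) →
      (T.map (slDim n)).sum ≤
        2 * (T.map fun β => headSum n β / (n : ℚ) * slDim n β).sum := by
    intro T hT
    rw [← Multiset.sum_map_mul_left]
    exact Multiset.sum_map_le_sum_map _ _ fun β hβ => hslope β (hT β hβ).1 (hT β hβ).2
  have hmem : lw [1, 1] ∈ S := by
    by_contra hmem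
    have := hsum S fun β hβ => ⟨hβ, fun e => hmem (e ▸ hβ)⟩
    rw [hr, hd] at this
    nlinarith
  obtain ⟨T, rfl⟩ := Multiset.exists_cons_of_mem hmem
  have hw' : ∀ β ∈ T, IsOGrOddWeight n β ∧ β ≠ 0 := fun β hβ =>
    have := hw β (Multiset.mem_cons_of_mem hβ)
    ⟨this.1, this.2.1⟩
  have hH11 : headSum n (lw [1, 1]) / (n : ℚ) * slDim n (lw [1, 1]) = n - 1 := by
    rw [headSum_one_one (by omega), slDim_one_one (by omega)]
    field_simp
  rw [Multiset.map_cons, Multiset.sum_cons] at hr hd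
  rw [hH11] at hd
  rw [slDim_one_one (by omega)] at hr
  have hdT : (T.map fun β => headSum n β / (n : ℚ) * slDim n β).sum = 1 := by linarith
  have hrT : (T.map (slDim n)).sum = n - 4 := by linarith
  have hnot : ∀ β ∈ T, β ≠ lw [1, 1] := by
    rintro β hβ rfl
    have := le_sum_map_of_mem (fun γ hγ => (hw' γ hγ).1.dex_nonneg) hβ
    rw [hH11, hdT] at this
    linarith
  have hT2 := hsum T fun β hβ => ⟨Multiset.mem_cons_of_mem hβ, hnot β hβ⟩
  rw [hrT, hdT] at hT2
  have hn6 : n ≤ 6 := by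
    have : (n : ℚ) ≤ 6 := by linarith
    exact_mod_cast this
  obtain rfl | rfl : n = 5 ∨ n = 6 := by omega
  · exfalso
    have hT : AllConst 5 T := fun β hβ => by
      refine ⟨(hw' β hβ).1, (hw' β hβ).2, ?_⟩
      rcases (hw' β hβ).1.const_or_le_slDim with hc | hc
      · exact hc
      · have := le_sum_map_of_mem (fun γ hγ => (hw' γ hγ).1.slDim_nonneg) hβ
        push_cast at hc hrT
        linarith
    rw [hT.sum_slDim] at hrT
    rw [hT.sum_dex (by omega)] at hdT
    have hcard : Multiset.card T = 1 := by
      have : (Multiset.card T : ℚ) = 1 := by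
        rw [hrT]
        norm_num
      exact_mod_cast this
    obtain ⟨γ, rfl⟩ := Multiset.card_eq_one.1 hcard
    rw [Multiset.map_singleton, Multiset.sum_singleton] at hdT
    obtain ⟨β, hβ, i, hi, hz⟩ := hnew
    rcases Multiset.mem_cons.1 hβ with rfl | hβ
    · rcases i with _ | _ | i
      · exact hz 1 (by simp [lw])
      · exact hz 1 (by simp [lw])
      · exact hz 0 (by simp [lw])
    · obtain rfl := Multiset.mem_singleton.1 hβ
      exact hz 1 (by rw [(hT β hβ).2.2 i hi, hdT]; simp)
  · refine ⟨rfl, ?_⟩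
    rw [eq_half_pair (by norm_num) hw' (by rw [hrT]; norm_num) hdT, cons_pair_eq]

/-- Classification of fourfolds with trivial canonical bundle in the maximal odd
orthogonal Grassmannians `OGr(n,2n+1)`, where `rank(β) = D_n(β)`. -/
theorem stmt15 (n : ℕ) (hn : 2 ≤ n)
    (S : Multiset (ℕ → ℚ))
    (hw : ∀ β ∈ S, IsOGrOddWeight n β ∧ β ≠ 0 ∧ β ≠ lw [1])
    (hnew : ∃ β ∈ S, ∃ i, i < n ∧ ∀ z : ℤ, β i ≠ (z : ℚ))
    (hr : (S.map (slDim n)).sum = (n : ℚ) * ((n : ℚ) + 1) / 2 - 4)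
    (hd : (S.map (fun β => headSum n β / (n : ℚ) * slDim n β)).sum = (n : ℚ)) :
    (n = 3 ∧ S = {lw [1/2, 1/2, 1/2], lw [5/2, 5/2, 5/2]}) ∨
    (n = 3 ∧ S = {lw [3/2, 3/2, 3/2], lw [3/2, 3/2, 3/2]}) ∨
    (n = 4 ∧ S = {lw [1/2, 1/2, 1/2, 1/2], lw [1/2, 1/2, 1/2, 1/2], lw [1, 1, 1]}) ∨
    (n = 4 ∧ S = {lw [1/2, 1/2, 1/2, 1/2], lw [1/2, 1/2, 1/2, 1/2],
      lw [3/2, 1/2, 1/2, 1/2]}) ∨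
    (n = 4 ∧ S = Multiset.replicate 5 (lw [1/2, 1/2, 1/2, 1/2]) +
      {lw [3/2, 3/2, 3/2, 3/2]}) ∨
    (n = 4 ∧ S = Multiset.replicate 4 (lw [1/2, 1/2, 1/2, 1/2]) +
      {lw [1, 1, 1, 1], lw [1, 1, 1, 1]}) ∨
    (n = 6 ∧ S = {lw [1/2, 1/2, 1/2, 1/2, 1/2, 1/2],
      lw [1/2, 1/2, 1/2, 1/2, 1/2, 1/2], lw [1, 1]}) := by
  obtain rfl | rfl | rfl | h5 : n = 2 ∨ n = 3 ∨ n = 4 ∨ 5 ≤ n := by omega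
  · have := sum_map_nonneg_of_mem fun γ hγ => (hw γ hγ).1.slDim_nonneg
    rw [hr] at this
    norm_num at this
  · rcases classification_three S (fun β hβ => ⟨(hw β hβ).1, (hw β hβ).2.1⟩) hnew
      (by rw [hr]; norm_num) (by rw [hd]; norm_num) with h | h
    · rw [constWeight_eq_lw, constWeight_eq_lw] at h
      exact Or.inl ⟨rfl, h⟩
    · rw [constWeight_eq_lw] at h
      exact Or.inr (Or.inl ⟨rfl, h⟩)
  · rcases classification_four S hw (by rw [hr]; norm_num) (by rw [hd]; norm_num)
      with h | h | h | h <;> rw [constWeight_eq_lw] at h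
    · exact Or.inr (Or.inr (Or.inl ⟨rfl, h⟩))
    · exact Or.inr (Or.inr (Or.inr (Or.inl ⟨rfl, h⟩)))
    · rw [constWeight_eq_lw] at h
      exact Or.inr (Or.inr (Or.inr (Or.inr (Or.inl ⟨rfl, h⟩))))
    · rw [constWeight_eq_lw] at h
      exact Or.inr (Or.inr (Or.inr (Or.inr (Or.inr (Or.inl ⟨rfl, h⟩)))))
  · obtain ⟨rfl, h⟩ := classification_of_five_le h5 S hw hnew hr hd
    rw [constWeight_eq_lw] at h
    exact Or.inr (Or.inr (Or.inr (Or.inr (Or.inr (Or.inr ⟨rfl, h⟩)))))
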